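/- Let φ(x) = (1/√(2π))·exp(−x²/2) and Φ(x) = ∫_{−∞}^x φ(t) dt, and for ε ∈ (0,1], α ≥ 0 define M_C(ε,α) = ε(1+α²) + (1−ε)[√(2π)·φ(√2·α) − 2α√π·Φ(−√2·α)]. Then for every ε with 0 < ε < 1 there exists α > 0 such that M_C(ε,α) < 1; consequently inf_{α ≥ 0} M_C(ε,α) < 1 and hence 2·inf_{α ≥ 0} M_C(ε,α) < 2. -/

import Mathlib

open MeasureTheory

/-- Standard Gaussian density. -/
noncomputable def phi (x : ℝ) : ℝ := (1 / Real.sqrt (2 * Real.pi)) * Real.exp (-x ^ 2 / 2)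

/-- Standard Gaussian cumulative distribution function. -/
noncomputable def Phi (x : ℝ) : ℝ := ∫ t in Set.Iic x, phi t

/-- Worst-case normalized MSE of complex soft thresholding. -/
noncomputable def MC (ε α : ℝ) : ℝ :=
  ε * (1 + α ^ 2) + (1 - ε) *
    (Real.sqrt (2 * Real.pi) * phi (Real.sqrt 2 * α)
      - 2 * α * Real.sqrt Real.pi * Phi (-(Real.sqrt 2 * α)))

theorem phi_pos (x : ℝ) : 0 < phi x := by
  unfold phi
  positivity

theorem integrable_phi : Integrable phi := by
  have h := (integrable_exp_neg_mul_sq (b := 1 / 2) (by norm_num)).const_mul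
    (1 / Real.sqrt (2 * Real.pi))
  convert h using 1
  ext x
  simp only [phi]
  congr 2
  ring

theorem Phi_pos (x : ℝ) : 0 < Phi x := by
  unfold Phi
  rw [setIntegral_pos_iff_support_of_nonneg_ae
    (Filter.Eventually.of_forall fun t => (phi_pos t).le) integrable_phi.integrableOn]
  have h : Function.support phi = Set.univ :=
    Set.eq_univ_of_forall fun t => (phi_pos t).ne'
  simp [h]

theorem Phi_mono : Monotone Phi := fun _ _ hxy =>
  setIntegral_mono_set integrable_phi.integrableOn
    (Filter.Eventually.of_forall fun t => (phi_pos t).le)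
    (Set.Iic_subset_Iic.mpr hxy).eventuallyLE

theorem sqrt_two_pi_mul_phi_le_one (x : ℝ) : Real.sqrt (2 * Real.pi) * phi x ≤ 1 := by
  have h : Real.sqrt (2 * Real.pi) ≠ 0 := by positivity
  have he : Real.exp (-x ^ 2 / 2) ≤ 1 := Real.exp_le_one_iff.mpr (by nlinarith [sq_nonneg x])
  rw [phi, ← mul_assoc, mul_one_div_cancel h, one_mul]
  exact he

theorem exists_pos_MC_lt_one (ε : ℝ) (h0 : 0 < ε) (h1 : ε < 1) : ∃ α : ℝ, 0 < α ∧ MC ε α < 1 := by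
  obtain ⟨c, hc⟩ : ∃ c, c = 2 * Real.sqrt Real.pi * Phi (-Real.sqrt 2) := ⟨_, rfl⟩
  have hc0 : 0 < c := by
    have := Phi_pos (-Real.sqrt 2)
    rw [hc]
    positivity
  have hε : 0 < 1 - ε := sub_pos.mpr h1
  obtain ⟨α, hα⟩ : ∃ α, α = (1 - ε) * c / (1 + c) := ⟨_, rfl⟩
  have hα0 : 0 < α := by rw [hα]; positivity
  have hα1 : α ≤ 1 := by
    rw [hα, div_le_one (by positivity)]
    nlinarith
  have hαc : α < (1 - ε) * c := by
    rw [hα]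
    exact div_lt_self (by positivity) (by linarith)
  have hPhi : α * c ≤ 2 * α * Real.sqrt Real.pi * Phi (-(Real.sqrt 2 * α)) := by
    have hm : Phi (-Real.sqrt 2) ≤ Phi (-(Real.sqrt 2 * α)) :=
      Phi_mono (neg_le_neg (mul_le_of_le_one_right (Real.sqrt_nonneg 2) hα1))
    calc α * c = 2 * α * Real.sqrt Real.pi * Phi (-Real.sqrt 2) := by rw [hc]; ring
      _ ≤ _ := by gcongr
  refine ⟨α, hα0, ?_⟩
  calc MC ε α ≤ ε * (1 + α ^ 2) + (1 - ε) * (1 - α * c) := by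
        unfold MC
        gcongr
        exact sqrt_two_pi_mul_phi_le_one _
    _ = 1 - α * ((1 - ε) * c - ε * α) := by ring
    _ < 1 := by
        have : 0 < (1 - ε) * c - ε * α := by nlinarith
        linarith [mul_pos hα0 this]

/-- For every `0 < ε < 1` there is `α > 0` with `M_C(ε,α) < 1`; hence
`inf_{α ≥ 0} M_C(ε,α) < 1` and `2·inf_{α ≥ 0} M_C(ε,α) < 2` (so `δ† < 2`). -/
theorem stmt_8 (ε : ℝ) (h0 : 0 < ε) (h1 : ε < 1) :
    (∃ α : ℝ, 0 < α ∧ MC ε α < 1) ∧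
    sInf (MC ε '' Set.Ici 0) < 1 ∧
    2 * sInf (MC ε '' Set.Ici 0) < 2 := by
  obtain ⟨α, hα0, hα⟩ := exists_pos_MC_lt_one ε h0 h1
  have hinf : sInf (MC ε '' Set.Ici 0) < 1 := by
    by_cases hb : BddBelow (MC ε '' Set.Ici 0)
    · exact (csInf_le hb ⟨α, hα0.le, rfl⟩).trans_lt hα
    · rw [Real.sInf_of_not_bddBelow hb]
      exact one_pos
  exact ⟨⟨α, hα0, hα⟩, hinf, by linarith⟩
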